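/- arXiv:1307.3413 — 2 statements merged into one kernel-verified Lean document; each statement's English description precedes it below -/
import Mathlib

section
/- For every integer M ≥ 3, reals κ₁ < κ₂ < ⋯ < κ_M, time parameter s > 0, nonnegative reals k̃₁,…,k̃_M with k̃₁ = k̃_M = 0, and every P ∈ 𝕊^M, there exists a pair (G, l) solving the G-system with time parameter s and probability vector P; in particular G = (G₁,…,G_M) has G_j ≥ 0 for all j and G₁ = G_M = 0. -/
noncomputable section

open Finset

/-- `p ∈ 𝕊^M`. -/
def ProbVec (M : ℕ) (p : ℕ → ℝ) : Prop :=
  (∀ j, 1 ≤ j → j ≤ M → 0 < p j) ∧ ∑ j ∈ Finset.Icc 1 M, p j = 1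

/-- The point `x₀` of the G-system, for probability vector `P` and candidate solution `G`. -/
def Gx0 (M : ℕ) (s : ℝ) (κ kt P G : ℕ → ℝ) : ℝ :=
  (∑ j ∈ Finset.Icc 1 M, κ j * P j * (1 + s * G j * kt j)) /
    (∑ j ∈ Finset.Icc 1 M, P j * (1 + s * G j * kt j))

/-- `(G, l)` solves the G-system with time parameter `s`, coordinates `κ`,
killing weights `kt` and probability vector `P`. -/
def GSystem (M : ℕ) (s : ℝ) (κ kt P G : ℕ → ℝ) (l : ℕ) : Prop :=
  2 ≤ l ∧ l ≤ M ∧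
  (∀ j, 1 ≤ j → j ≤ M → 0 ≤ G j) ∧ G 1 = 0 ∧ G M = 0 ∧
  κ (l - 1) < Gx0 M s κ kt P G ∧ Gx0 M s κ kt P G ≤ κ l ∧
  (∀ j, 2 ≤ j → j ≤ l - 1 →
    G j = (1 / (s * P j)) *
      ((κ (j + 1) - κ (j - 1)) / ((κ (j + 1) - κ j) * (κ j - κ (j - 1)))) *
      ∑ a ∈ Finset.Icc 1 (j - 1), (κ j - κ a) * P a * (1 + s * G a * kt a)) ∧
  (∀ j, l ≤ j → j ≤ M - 1 →
    G j = (1 / (s * P j)) *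
      ((κ (j + 1) - κ (j - 1)) / ((κ (j + 1) - κ j) * (κ j - κ (j - 1)))) *
      ∑ a ∈ Finset.Icc (j + 1) M, (κ a - κ j) * P a * (1 + s * G a * kt a))

/-- Recursion along a measure for sequences given by finite sums over earlier terms. -/
lemma exists_eq_mul_sum (S : ℕ → Finset ℕ) (μ : ℕ → ℕ) (hS : ∀ j, ∀ a ∈ S j, μ a < μ j)
    (c : ℕ → ℝ) (F : ℕ → ℕ → ℝ → ℝ) :
    ∃ g : ℕ → ℝ, ∀ j, g j = c j * ∑ a ∈ S j, F j a (g a) := by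
  have wf : WellFounded (fun a b : ℕ => μ a < μ b) := (measure μ).wf
  refine ⟨wf.fix (C := fun _ => ℝ) fun j g => c j * ∑ a ∈ (S j).attach, F j a (g a (hS j a a.2)), fun j => ?_⟩
  rw [wf.fix_eq]
  congr 1
  exact Finset.sum_attach (S j) fun a => F j a (wf.fix (C := fun _ => ℝ) _ a)

lemma sum_sub_mul_eq_split (M m : ℕ) (h1 : 1 ≤ m) (hm : m ≤ M) (κ w : ℕ → ℝ) :
    ∑ j ∈ Finset.Icc 1 M, (κ j - κ m) * w j =
      ∑ a ∈ Finset.Icc (m + 1) M, (κ a - κ m) * w a -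
        ∑ a ∈ Finset.Icc 1 (m - 1), (κ m - κ a) * w a := by
  have h : Finset.Icc 1 M = insert m (Finset.Icc 1 (m - 1) ∪ Finset.Icc (m + 1) M) := by
    ext x
    simp only [Finset.mem_Icc, Finset.mem_insert, Finset.mem_union]
    omega
  have hd : Disjoint (Finset.Icc 1 (m - 1)) (Finset.Icc (m + 1) M) := by
    rw [Finset.disjoint_left]
    intro x
    simp only [Finset.mem_Icc]
    omega
  rw [h, Finset.sum_insert (by simp only [Finset.mem_Icc, Finset.mem_union]; omega),
    Finset.sum_union hd, sub_self, zero_mul, zero_add, sub_eq_add_neg, add_comm,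
    ← Finset.sum_neg_distrib]
  congr 1
  exact Finset.sum_congr rfl fun a _ => by ring

lemma strictMonoOn_Icc_of_lt_succ (M : ℕ) (κ : ℕ → ℝ)
    (hκ : ∀ j, 1 ≤ j → j ≤ M - 1 → κ j < κ (j + 1)) {i j : ℕ} (hi : 1 ≤ i) (hij : i < j)
    (hj : j ≤ M) : κ i < κ j := by
  induction j, hij using Nat.le_induction with
  | base => exact hκ i hi (by omega)
  | succ k hk ih => exact (ih (by omega)).trans (hκ k (by omega) (by omega))

/-- For any `M ≥ 3`, increasing `κ₁ < ⋯ < κ_M`, time `s > 0`,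
nonnegative `k̃` with `k̃₁ = k̃_M = 0`, and `P ∈ 𝕊^M`, there is a pair `(G, l)` solving
the G-system with time parameter `s` and probability vector `P`; in particular `G` is
nonnegative and `G₁ = G_M = 0` (these are part of `GSystem`). -/
theorem stmt_0 (M : ℕ) (hM : 3 ≤ M) (s : ℝ) (hs : 0 < s) (κ kt P : ℕ → ℝ)
    (hκ : ∀ j, 1 ≤ j → j ≤ M - 1 → κ j < κ (j + 1))
    (hkt : ∀ j, 1 ≤ j → j ≤ M → 0 ≤ kt j) (hkt1 : kt 1 = 0) (hktM : kt M = 0)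
    (hP : ProbVec M P) :
    ∃ G : ℕ → ℝ, ∃ l : ℕ, GSystem M s κ kt P G l := by
  obtain ⟨hP, -⟩ := hP
  have hmono : ∀ i j, 1 ≤ i → i < j → j ≤ M → κ i < κ j := fun i j hi hij hj =>
    strictMonoOn_Icc_of_lt_succ M κ hκ hi hij hj
  set c : ℕ → ℝ := fun j => (1 / (s * P j)) *
    ((κ (j + 1) - κ (j - 1)) / ((κ (j + 1) - κ j) * (κ j - κ (j - 1)))) with hc
  have hc0 : ∀ j, 2 ≤ j → j ≤ M - 1 → 0 ≤ c j := by
    intro j h2 hj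
    have e1 := sub_pos.2 (hmono j (j + 1) (by omega) (by omega) (by omega))
    have e2 := sub_pos.2 (hmono (j - 1) j (by omega) (by omega) (by omega))
    have e3 := sub_pos.2 (hmono (j - 1) (j + 1) (by omega) (by omega) (by omega))
    have e4 := hP j (by omega) (by omega)
    simp only [hc]
    positivity
  -- the two one-sided recursions, started from the left and right end points
  obtain ⟨gL, hgL⟩ := exists_eq_mul_sum (fun j => Finset.Icc 1 (j - 1)) id
    (by intro j a ha; simp only [Finset.mem_Icc, id] at ha ⊢; omega) c
    (fun j a g => (κ j - κ a) * P a * (1 + s * g * kt a))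
  obtain ⟨gR, hgR⟩ := exists_eq_mul_sum (fun j => Finset.Icc (j + 1) M) (fun j => M - j)
    (by intro j a ha; simp only [Finset.mem_Icc] at ha ⊢; omega) c
    (fun j a g => (κ a - κ j) * P a * (1 + s * g * kt a))
  have hw : ∀ g : ℝ, 0 ≤ g → ∀ a, 1 ≤ a → a ≤ M → 0 < 1 + s * g * kt a := by
    intro g hg a h1 h2
    have := hkt a h1 h2
    positivity
  have hgL1 : gL 1 = 0 := by rw [hgL]; simp
  have hgRM : gR M = 0 := by rw [hgR]; simp
  have hgL0 : ∀ j, 1 ≤ j → j ≤ M - 1 → 0 ≤ gL j := by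
    intro j
    induction j using Nat.strong_induction_on with
    | _ j ih =>
      intro h1 hj
      rcases h1.eq_or_lt with rfl | h2
      · exact hgL1.ge
      rw [hgL]
      refine mul_nonneg (hc0 j h2 hj) (Finset.sum_nonneg fun a ha => ?_)
      rw [Finset.mem_Icc] at ha
      have e1 := sub_pos.2 (hmono a j (by omega) (by omega) (by omega))
      have e2 := hP a (by omega) (by omega)
      have e3 := hw _ (ih a (by omega) (by omega) (by omega)) a (by omega) (by omega)
      positivity
  have hgR0 : ∀ n j, M - j = n → 2 ≤ j → j ≤ M → 0 ≤ gR j := by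
    intro n
    induction n using Nat.strong_induction_on with
    | _ n ih =>
      intro j hn h2 hj
      rcases hj.eq_or_lt with rfl | hj
      · exact hgRM.ge
      rw [hgR]
      refine mul_nonneg (hc0 j h2 (by omega)) (Finset.sum_nonneg fun a ha => ?_)
      rw [Finset.mem_Icc] at ha
      have e1 := sub_pos.2 (hmono j a (by omega) (by omega) (by omega))
      have e2 := hP a (by omega) (by omega)
      have e3 := hw _ (ih (M - a) (by omega) a rfl (by omega) (by omega)) a (by omega) (by omega)
      positivity
  set A : ℕ → ℝ := fun m => ∑ a ∈ Finset.Icc 1 (m - 1),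
    (κ m - κ a) * P a * (1 + s * gL a * kt a) with hA
  set B : ℕ → ℝ := fun m => ∑ a ∈ Finset.Icc (m + 1) M,
    (κ a - κ m) * P a * (1 + s * gR a * kt a) with hB
  have hex : ∃ m, 1 ≤ m ∧ m ≤ M ∧ B m ≤ A m := by
    refine ⟨M, by omega, le_rfl, ?_⟩
    have : B M = 0 := by simp [hB]
    rw [this]
    refine Finset.sum_nonneg fun a ha => ?_
    rw [Finset.mem_Icc] at ha
    have e1 := sub_pos.2 (hmono a M (by omega) (by omega) (by omega))
    have e2 := hP a (by omega) (by omega)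
    have e3 := hw _ (hgL0 a (by omega) (by omega)) a (by omega) (by omega)
    positivity
  -- the index `l` is the first crossing of the two one-sided moments
  classical
  obtain ⟨l, ⟨hl1, hlM, hl⟩, hmin⟩ : ∃ l, (1 ≤ l ∧ l ≤ M ∧ B l ≤ A l) ∧
      ∀ m < l, ¬(1 ≤ m ∧ m ≤ M ∧ B m ≤ A m) :=
    ⟨Nat.find hex, Nat.find_spec hex, fun m hm => Nat.find_min hex hm⟩
  have hB1 : A 1 < B 1 := by
    have : A 1 = 0 := by simp [hA]
    rw [this]
    refine Finset.sum_pos (fun a ha => ?_) ⟨2, by simp only [Finset.mem_Icc]; omega⟩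
    rw [Finset.mem_Icc] at ha
    have e1 := sub_pos.2 (hmono 1 a (by omega) (by omega) (by omega))
    have e2 := hP a (by omega) (by omega)
    have e3 := hw _ (hgR0 _ a rfl (by omega) (by omega)) a (by omega) (by omega)
    positivity
  have hl2 : 2 ≤ l := by
    rcases hl1.eq_or_lt with rfl | h
    · exact absurd hl (not_le.2 hB1)
    · exact h
  have hl' : A (l - 1) < B (l - 1) := by
    by_contra h
    exact hmin (l - 1) (by omega) ⟨by omega, by omega, not_lt.1 h⟩
  set G : ℕ → ℝ := fun j => if j < l then gL j else gR j with hG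
  have hGl : ∀ j, j < l → G j = gL j := fun j hj => if_pos hj
  have hGr : ∀ j, l ≤ j → G j = gR j := fun j hj => if_neg (not_lt.2 hj)
  have hG0 : ∀ j, 1 ≤ j → j ≤ M → 0 ≤ G j := by
    intro j h1 h2
    rcases lt_or_ge j l with h | h
    · rw [hGl j h]; exact hgL0 j h1 (by omega)
    · rw [hGr j h]; exact hgR0 _ j rfl (by omega) h2
  have hAG : ∀ m ≤ l, ∑ a ∈ Finset.Icc 1 (m - 1),
      (κ m - κ a) * P a * (1 + s * G a * kt a) = A m := by
    intro m hm
    refine Finset.sum_congr rfl fun a ha => ?_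
    rw [Finset.mem_Icc] at ha
    rw [hGl a (by omega)]
  have hBG : ∀ m, l - 1 ≤ m → ∑ a ∈ Finset.Icc (m + 1) M,
      (κ a - κ m) * P a * (1 + s * G a * kt a) = B m := by
    intro m hm
    refine Finset.sum_congr rfl fun a ha => ?_
    rw [Finset.mem_Icc] at ha
    rw [hGr a (by omega)]
  have hW : 0 < ∑ j ∈ Finset.Icc 1 M, P j * (1 + s * G j * kt j) := by
    refine Finset.sum_pos (fun a ha => ?_) ⟨1, by simp only [Finset.mem_Icc]; omega⟩
    rw [Finset.mem_Icc] at ha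
    exact mul_pos (hP a ha.1 ha.2) (hw _ (hG0 a ha.1 ha.2) a ha.1 ha.2)
  have hsplit : ∀ m, l - 1 ≤ m → m ≤ l →
      ∑ j ∈ Finset.Icc 1 M, κ j * P j * (1 + s * G j * kt j) -
        κ m * ∑ j ∈ Finset.Icc 1 M, P j * (1 + s * G j * kt j) = B m - A m := by
    intro m h1 h2
    rw [← hAG m h2, ← hBG m h1, Finset.mul_sum, ← Finset.sum_sub_distrib]
    have h := sum_sub_mul_eq_split M m (by omega) (by omega) κ
      (fun j => P j * (1 + s * G j * kt j))
    simp only [sub_mul, mul_assoc] at h ⊢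
    exact h
  refine ⟨G, l, hl2, hlM, hG0, ?_, ?_, ?_, ?_, ?_, ?_⟩
  · rw [hGl 1 (by omega), hgL1]
  · rw [hGr M hlM, hgRM]
  · rw [Gx0, lt_div_iff₀ hW]
    have := hsplit (l - 1) le_rfl (by omega)
    linarith
  · rw [Gx0, div_le_iff₀ hW]
    have := hsplit l (by omega) le_rfl
    linarith
  · intro j h2 hj
    rw [hAG j (by omega), hGl j (by omega), hgL j]
  · intro j hj hjM
    rw [hBG j (by omega), hGr j hj, hgR j]
end
end

section
/- Let p ∈ 𝕊^M and t > 0. There exist a unique α ∈ (0,1], l ∈ {2,…,M}, x₀ ∈ (κ_{l−1}, κ_l], and intensity vector λ = (λ₂,…,λ_{M−1}) with λ_j ≥ 0 such that, setting p̂ = (αp₁,…,αp_M, 1−α) (a row vector of length M+1), the row vector p̂·Ñ_t(λ) has k-th entry equal to (x₀−κ_{l−1})/(κ_l−κ_{l−1}) for k = l, equal to (κ_l−x₀)/(κ_l−κ_{l−1}) for k = l−1, and equal to 0 for every other k ∈ {1,…,M+1}. Moreover the solution necessarily satisfies α = 1/(1 + t∑_{j=1}^M p_jλ_j k̃_j)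 (with λ₁ = λ_M = 0), x₀ = (∑_{j=1}^M κ_j p_j(1+tλ_j k̃_j))/(∑_{j=1}^M p_j(1+tλ_j k̃_j)), and ((λ₁,…,λ_M), l) solves the G-system with time parameter t and probability vector p. -/
noncomputable section

open Finset MeasureTheory

/-- Paper index `j ∈ {1,…,M+1}` as an element of `Fin (M+1)`. -/
def fid (M j : ℕ) : Fin (M + 1) := ⟨(j - 1) % (M + 1), Nat.mod_lt _ (Nat.succ_pos M)⟩

/-- `q_{j,j+1}` built from the grid `i` and the drift `b`. -/
def qup (i b : ℕ → ℝ) (j : ℕ) : ℝ :=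
  ((i j - i (j - 1)) / (i (j + 1) - i (j - 1))) * (1 + (i (j + 1) - i j) * b j)

/-- `q_{j,j-1}` built from the grid `i` and the drift `b`. -/
def qdn (i b : ℕ → ℝ) (j : ℕ) : ℝ :=
  ((i (j + 1) - i j) / (i (j + 1) - i (j - 1))) * (1 - (i j - i (j - 1)) * b j)

/-- `k̃_j = (i_{j+1}-i_j)(i_j-i_{j-1}) k_j` for `2 ≤ j ≤ M-1`, and `0` otherwise. -/
def ktil (M : ℕ) (i k : ℕ → ℝ) (j : ℕ) : ℝ :=
  if 2 ≤ j ∧ j ≤ M - 1 then (i (j + 1) - i j) * (i j - i (j - 1)) * k j else 0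

/-- The drift hypothesis `-1/(i_{j+1}-i_j) < b_j < 1/(i_j - i_{j-1})`. -/
def DriftHyp (M : ℕ) (i b : ℕ → ℝ) : Prop :=
  ∀ j, 2 ≤ j → j ≤ M - 1 →
    -(1 / (i (j + 1) - i j)) < b j ∧ b j < 1 / (i j - i (j - 1))

/-- An intensity vector: nonnegative on `{2,…,M-1}` and (by convention) `0` elsewhere. -/
def IntensityVec (M : ℕ) (lam : ℕ → ℝ) : Prop :=
  (∀ j, 2 ≤ j → j ≤ M - 1 → 0 ≤ lam j) ∧ (∀ j, ¬(2 ≤ j ∧ j ≤ M - 1) → lam j = 0)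

/-- `κ` are martingale coordinates for `(i,b)`. -/
def MartCoord (M : ℕ) (i b κ : ℕ → ℝ) : Prop :=
  (∀ j, 1 ≤ j → j ≤ M - 1 → κ j < κ (j + 1)) ∧
  (∀ j, 2 ≤ j → j ≤ M - 1 →
    qup i b j = (κ j - κ (j - 1)) / (κ (j + 1) - κ (j - 1)) ∧
    qdn i b j = (κ (j + 1) - κ j) / (κ (j + 1) - κ (j - 1)))

/-- Entry `(j,c)` (paper indices in `{1,…,M+1}`) of the matrix `Ñ_t(λ)`. -/
def NtE (M : ℕ) (t : ℝ) (i b k lam : ℕ → ℝ) (j c : ℕ) : ℝ :=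
  if 2 ≤ j ∧ j ≤ M - 1 then
    if c = j then 1 + t * lam j * (1 + ktil M i k j)
    else if c = j + 1 then -(t * lam j * qup i b j)
    else if c = j - 1 then -(t * lam j * qdn i b j)
    else if c = M + 1 then -(t * lam j * ktil M i k j)
    else 0
  else if c = j then 1 else 0

/-- The `(M+1)×(M+1)` matrix `Ñ_t(λ)`. -/
def Ntilde (M : ℕ) (t : ℝ) (i b k lam : ℕ → ℝ) : Matrix (Fin (M + 1)) (Fin (M + 1)) ℝ :=
  Matrix.of fun u v => NtE M t i b k lam (u.1 + 1) (v.1 + 1)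

/-- The top-left `M×M` block `N_t(λ)` of `Ñ_t(λ)`. -/
def NMat (M : ℕ) (t : ℝ) (i b k lam : ℕ → ℝ) : Matrix (Fin M) (Fin M) ℝ :=
  Matrix.of fun u v => NtE M t i b k lam (u.1 + 1) (v.1 + 1)

/-- Entry `(j,c)` (paper indices) of the one-step transition matrix `P̃^{(h)}(λ)`. -/
def PtE (M : ℕ) (h : ℝ) (i b k lam : ℕ → ℝ) (j c : ℕ) : ℝ :=
  if 2 ≤ j ∧ j ≤ M - 1 then
    if c = j then 1 - h * lam j * (1 + ktil M i k j)
    else if c = j + 1 then h * lam j * qup i b j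
    else if c = j - 1 then h * lam j * qdn i b j
    else if c = M + 1 then h * lam j * ktil M i k j
    else 0
  else if c = j then 1 else 0

/-- The `(M+1)×(M+1)` transition matrix `P̃^{(h)}(λ)`. -/
def Ptilde (M : ℕ) (h : ℝ) (i b k lam : ℕ → ℝ) : Matrix (Fin (M + 1)) (Fin (M + 1)) ℝ :=
  Matrix.of fun u v => PtE M h i b k lam (u.1 + 1) (v.1 + 1)

/-- Entry `(j,c)` (paper indices) of the intensity matrix `Θ(λ)`. -/
def ThE (M : ℕ) (i b k lam : ℕ → ℝ) (j c : ℕ) : ℝ :=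
  if 2 ≤ j ∧ j ≤ M - 1 then
    if c = j then -(lam j * (1 + ktil M i k j))
    else if c = j + 1 then lam j * qup i b j
    else if c = j - 1 then lam j * qdn i b j
    else if c = M + 1 then lam j * ktil M i k j
    else 0
  else 0

/-- The `(M+1)×(M+1)` intensity matrix `Θ(λ)`. -/
def Theta (M : ℕ) (i b k lam : ℕ → ℝ) : Matrix (Fin (M + 1)) (Fin (M + 1)) ℝ :=
  Matrix.of fun u v => ThE M i b k lam (u.1 + 1) (v.1 + 1)


/-- The solution property of Statement 1: `α ∈ (0,1]`, `l ∈ {2,…,M}`, `x₀ ∈ (κ_{l-1}, κ_l]`,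
`λ` an intensity vector, and the row vector `p̂ = (αp₁,…,αp_M, 1-α)` satisfies
`(p̂ · Ñ_t(λ))_c = (x₀-κ_{l-1})/(κ_l-κ_{l-1})` for `c = l`,
`(κ_l-x₀)/(κ_l-κ_{l-1})` for `c = l-1`, and `0` otherwise. -/
def Sol1 (M : ℕ) (t : ℝ) (i b k κ p : ℕ → ℝ) (α : ℝ) (l : ℕ) (x0 : ℝ)
    (lam : ℕ → ℝ) : Prop :=
  IntensityVec M lam ∧ 0 < α ∧ α ≤ 1 ∧ 2 ≤ l ∧ l ≤ M ∧
  κ (l - 1) < x0 ∧ x0 ≤ κ l ∧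
  ∀ c, 1 ≤ c → c ≤ M + 1 →
    (∑ j ∈ Finset.Icc 1 (M + 1),
        (if j = M + 1 then 1 - α else α * p j) * NtE M t i b k lam j c)
      = (if c = l then (x0 - κ (l - 1)) / (κ l - κ (l - 1))
          else if c = l - 1 then (κ l - x0) / (κ l - κ (l - 1)) else 0)

/-- The weight `p_j (1 + t λ_j k̃_j)`. -/
def killWeight (t : ℝ) (p lam kt : ℕ → ℝ) (j : ℕ) : ℝ := p j * (1 + t * lam j * kt j)

/-- The harmonic factor `(κ_{j+1}-κ_j)(κ_j-κ_{j-1})/(κ_{j+1}-κ_{j-1})`. -/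
def cellFactor (κ : ℕ → ℝ) (j : ℕ) : ℝ :=
  (κ (j + 1) - κ j) * (κ j - κ (j - 1)) / (κ (j + 1) - κ (j - 1))

/-- The column `c` of the row vector `p̂ · Ñ_t(λ)`. -/
def rowEntry (M : ℕ) (t : ℝ) (i b k p : ℕ → ℝ) (α : ℝ) (lam : ℕ → ℝ) (c : ℕ) : ℝ :=
  ∑ j ∈ Finset.Icc 1 (M + 1),
    (if j = M + 1 then 1 - α else α * p j) * NtE M t i b k lam j c

/-- The law on `{l-1, l}` with mean `x0`. -/
def twoPoint (κ : ℕ → ℝ) (l : ℕ) (x0 : ℝ) (c : ℕ) : ℝ :=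
  if c = l then (x0 - κ (l - 1)) / (κ l - κ (l - 1))
  else if c = l - 1 then (κ l - x0) / (κ l - κ (l - 1)) else 0

lemma ktil_eq_zero {M : ℕ} (i k : ℕ → ℝ) {j : ℕ} (hj : ¬(2 ≤ j ∧ j ≤ M - 1)) :
    ktil M i k j = 0 := if_neg hj

lemma ktil_nonneg {M : ℕ} {i k : ℕ → ℝ} (hi : ∀ j, 1 ≤ j → j ≤ M - 1 → i j < i (j + 1))
    (hk : ∀ j, 2 ≤ j → j ≤ M - 1 → 0 ≤ k j) (j : ℕ) : 0 ≤ ktil M i k j := by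
  unfold ktil
  split_ifs with h
  · have h1 := hi j (by omega) h.2
    have h2 := hi (j - 1) (by omega) (by omega)
    rw [Nat.sub_add_cancel (by omega)] at h2
    exact mul_nonneg (mul_nonneg (by linarith) (by linarith)) (hk j h.1 h.2)
  · exact le_rfl

lemma coord_lt {M : ℕ} {κ : ℕ → ℝ} (hκ : ∀ j, 1 ≤ j → j ≤ M - 1 → κ j < κ (j + 1))
    {a c : ℕ} (ha : 1 ≤ a) (hac : a < c) (hc : c ≤ M) : κ a < κ c := by
  induction c, hac using Nat.le_induction with
  | base => exact hκ a ha (by omega)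
  | succ n hn ih => exact (ih (by omega)).trans (hκ n (by omega) (by omega))

lemma coord_le {M : ℕ} {κ : ℕ → ℝ} (hκ : ∀ j, 1 ≤ j → j ≤ M - 1 → κ j < κ (j + 1))
    {a c : ℕ} (ha : 1 ≤ a) (hac : a ≤ c) (hc : c ≤ M) : κ a ≤ κ c := by
  rcases hac.eq_or_lt with rfl | h
  · exact le_rfl
  · exact (coord_lt hκ ha h hc).le

lemma sum_NtE_mul {M j : ℕ} (hM : 3 ≤ M) (t : ℝ) (i b k lam f : ℕ → ℝ)
    (hj : 2 ≤ j ∧ j ≤ M - 1) :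
    ∑ c ∈ Icc 1 M, NtE M t i b k lam j c * f c =
      (1 + t * lam j * ktil M i k j) * f j -
        t * lam j * (qup i b j * f (j + 1) + qdn i b j * f (j - 1) - f j) := by
  have key : ∀ c ∈ Icc 1 M, NtE M t i b k lam j c * f c =
      (if c = j then (1 + t * lam j * (1 + ktil M i k j)) * f c else 0) +
      (if c = j + 1 then -(t * lam j * qup i b j) * f c else 0) +
      (if c = j - 1 then -(t * lam j * qdn i b j) * f c else 0) := by
    intro c hc
    rw [mem_Icc] at hc
    unfold NtE
    rw [if_pos hj]
    split_ifs <;> first | omega | simp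
  rw [sum_congr rfl key, sum_add_distrib, sum_add_distrib, sum_ite_eq', sum_ite_eq', sum_ite_eq',
    if_pos (mem_Icc.2 ⟨by omega, by omega⟩), if_pos (mem_Icc.2 ⟨by omega, by omega⟩),
    if_pos (mem_Icc.2 ⟨by omega, by omega⟩)]
  ring

lemma sum_rowEntry_mul {M : ℕ} (hM : 3 ≤ M) (t : ℝ) (i b k p : ℕ → ℝ) (α : ℝ)
    {lam : ℕ → ℝ} (hlam : IntensityVec M lam) (f : ℕ → ℝ) :
    ∑ c ∈ Icc 1 M, rowEntry M t i b k p α lam c * f c =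
      α * ∑ j ∈ Icc 1 M, (killWeight t p lam (ktil M i k) j * f j -
        p j * (t * lam j * (qup i b j * f (j + 1) + qdn i b j * f (j - 1) - f j))) := by
  have hswap : ∑ c ∈ Icc 1 M, rowEntry M t i b k p α lam c * f c =
      ∑ j ∈ Icc 1 (M + 1), (if j = M + 1 then 1 - α else α * p j) *
        ∑ c ∈ Icc 1 M, NtE M t i b k lam j c * f c := by
    simp only [rowEntry, sum_mul, mul_sum]
    rw [sum_comm]
    simp only [mul_assoc]
  rw [hswap, Finset.sum_Icc_succ_top (by omega)]
  have hlast : ∑ c ∈ Icc 1 M, NtE M t i b k lam (M + 1) c * f c = 0 := by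
    refine sum_eq_zero fun c hc => ?_
    rw [mem_Icc] at hc
    unfold NtE
    rw [if_neg (by omega), if_neg (by omega), zero_mul]
  rw [hlast, mul_zero, add_zero, mul_sum]
  refine sum_congr rfl fun j hj => ?_
  have hj' := mem_Icc.1 hj
  rw [if_neg (by omega)]
  by_cases h : 2 ≤ j ∧ j ≤ M - 1
  · rw [sum_NtE_mul hM t i b k lam f h, killWeight]
    ring
  · have : ∑ c ∈ Icc 1 M, NtE M t i b k lam j c * f c = f j := by
      have h1 : ∀ c ∈ Icc 1 M, NtE M t i b k lam j c * f c = if c = j then f c else 0 := by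
        intro c _
        unfold NtE
        rw [if_neg h]
        split_ifs <;> simp
      rw [sum_congr rfl h1, sum_ite_eq', if_pos hj]
    rw [this, killWeight, hlam.2 j h]
    ring

lemma rowEntry_last {M : ℕ} (hM : 3 ≤ M) (t : ℝ) (i b k p : ℕ → ℝ) (α : ℝ)
    (lam : ℕ → ℝ) :
    rowEntry M t i b k p α lam (M + 1) =
      1 - α * (1 + t * ∑ j ∈ Icc 1 M, p j * lam j * ktil M i k j) := by
  rw [rowEntry, Finset.sum_Icc_succ_top (by omega)]
  have h1 : ∀ j ∈ Icc 1 M, (if j = M + 1 then 1 - α else α * p j) *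
      NtE M t i b k lam j (M + 1) = -(α * t) * (p j * lam j * ktil M i k j) := by
    intro j hj
    rw [mem_Icc] at hj
    rw [if_neg (by omega)]
    by_cases h : 2 ≤ j ∧ j ≤ M - 1
    · unfold NtE
      rw [if_pos h, if_neg (by omega), if_neg (by omega), if_neg (by omega), if_pos rfl]
      ring
    · unfold NtE
      rw [if_neg h, if_neg (by omega), ktil_eq_zero i k h]
      ring
  rw [sum_congr rfl h1, ← mul_sum, if_pos rfl, NtE, if_neg (by omega), if_pos rfl]
  ring

lemma sum_killWeight {M : ℕ} {p : ℕ → ℝ} (hp : ProbVec M p) (t : ℝ) (lam kt : ℕ → ℝ) :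
    ∑ j ∈ Icc 1 M, killWeight t p lam kt j = 1 + t * ∑ j ∈ Icc 1 M, p j * lam j * kt j := by
  rw [← hp.2, mul_sum, ← sum_add_distrib]
  exact sum_congr rfl fun j _ => by rw [killWeight]; ring

lemma sum_twoPoint_mul {M l : ℕ} (hl : 2 ≤ l) (hlM : l ≤ M) (κ : ℕ → ℝ) (x0 : ℝ) (f : ℕ → ℝ) :
    ∑ c ∈ Icc 1 M, twoPoint κ l x0 c * f c =
      (x0 - κ (l - 1)) / (κ l - κ (l - 1)) * f l +
        (κ l - x0) / (κ l - κ (l - 1)) * f (l - 1) := by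
  have key : ∀ c ∈ Icc 1 M, twoPoint κ l x0 c * f c =
      (if c = l then (x0 - κ (l - 1)) / (κ l - κ (l - 1)) * f c else 0) +
      (if c = l - 1 then (κ l - x0) / (κ l - κ (l - 1)) * f c else 0) := by
    intro c _
    unfold twoPoint
    split_ifs <;> first | omega | simp
  rw [sum_congr rfl key, sum_add_distrib, sum_ite_eq', sum_ite_eq',
    if_pos (mem_Icc.2 ⟨by omega, by omega⟩), if_pos (mem_Icc.2 ⟨by omega, by omega⟩)]

/-- Call prices: the sum against a hinge is a sum over the indices to the right. -/
lemma sum_mul_hinge {M x : ℕ} {κ : ℕ → ℝ} (hκ : ∀ j, 1 ≤ j → j ≤ M - 1 → κ j < κ (j + 1))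
    (hx : 1 ≤ x) (hxM : x ≤ M) (w : ℕ → ℝ) :
    ∑ a ∈ Icc 1 M, w a * max (κ a - κ x) 0 = ∑ a ∈ Icc (x + 1) M, (κ a - κ x) * w a := by
  symm
  refine (sum_congr rfl fun a ha => ?_).trans (sum_subset ?_ ?_)
  · rw [mem_Icc] at ha
    rw [max_eq_left (sub_nonneg.2 (coord_le hκ hx (by omega) ha.2)), mul_comm]
  · exact Icc_subset_Icc (by omega) le_rfl
  · intro a ha hna
    rw [mem_Icc] at ha hna
    rw [max_eq_right (sub_nonpos.2 (coord_le hκ ha.1 (by omega) hxM)), mul_zero]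

/-- Put-call parity. -/
lemma sum_left_eq {M x : ℕ} (hx : 1 ≤ x) (hxM : x ≤ M) (κ w : ℕ → ℝ) :
    ∑ a ∈ Icc 1 (x - 1), (κ x - κ a) * w a =
      ∑ a ∈ Icc (x + 1) M, (κ a - κ x) * w a -
        (∑ a ∈ Icc 1 M, κ a * w a - κ x * ∑ a ∈ Icc 1 M, w a) := by
  have h : ∑ a ∈ Icc 1 M, (κ a - κ x) * w a =
      ∑ a ∈ Icc 1 (x - 1), (κ a - κ x) * w a + ∑ a ∈ Icc (x + 1) M, (κ a - κ x) * w a := by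
    have hd : Disjoint (Icc 1 (x - 1)) (Icc (x + 1) M) := by
      rw [Finset.disjoint_left]
      intro a ha hb
      rw [mem_Icc] at ha hb
      omega
    rw [← sum_union hd]
    symm
    refine sum_subset ?_ ?_
    · intro a ha
      rw [mem_union, mem_Icc, mem_Icc] at ha
      rw [mem_Icc]
      omega
    · intro a ha hna
      rw [mem_union, mem_Icc, mem_Icc] at hna
      rw [mem_Icc] at ha
      obtain rfl : a = x := by omega
      ring
  simp only [sub_mul, sum_sub_distrib, ← mul_sum] at h ⊢
  linarith

/-- A signed measure on the grid annihilated by affine functions and hinges vanishes. -/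
lemma eq_zero_of_moments {M : ℕ} (hM : 3 ≤ M) {κ : ℕ → ℝ}
    (hκ : ∀ j, 1 ≤ j → j ≤ M - 1 → κ j < κ (j + 1)) {e : ℕ → ℝ}
    (h0 : ∑ c ∈ Icc 1 M, e c = 0) (h1 : ∑ c ∈ Icc 1 M, e c * κ c = 0)
    (h2 : ∀ x, 2 ≤ x → x ≤ M - 1 → ∑ c ∈ Icc 1 M, e c * max (κ c - κ x) 0 = 0) :
    ∀ c, 1 ≤ c → c ≤ M → e c = 0 := by
  have hH : ∀ x, 1 ≤ x → x ≤ M - 1 → ∑ a ∈ Icc (x + 1) M, (κ a - κ x) * e a = 0 := by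
    intro x hx hxM
    rcases hx.eq_or_lt with rfl | hx'
    · have := sum_left_eq (x := 1) (M := M) le_rfl (by omega) κ e
      simp only [mul_comm (κ _) (e _), h1, h0] at this
      simpa using this.symm
    · rw [← sum_mul_hinge hκ hx (by omega), h2 x hx' hxM]
  have hpos : ∀ n c, M - c = n → 2 ≤ c → c ≤ M → e c = 0 := by
    intro n
    induction n using Nat.strong_induction_on with
    | _ n ih =>
      intro c hn hc hcM
      have h := hH (c - 1) (by omega) (by omega)
      rw [Nat.sub_add_cancel (by omega), sum_eq_single_of_mem c (mem_Icc.2 ⟨le_rfl, hcM⟩)] at h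
      · have := coord_lt hκ (a := c - 1) (c := c) (by omega) (by omega) hcM
        rcases mul_eq_zero.1 h with h | h
        · linarith
        · exact h
      · intro a ha hne
        rw [mem_Icc] at ha
        rw [ih (M - a) (by omega) a rfl (by omega) ha.2, mul_zero]
  intro c hc hcM
  rcases hc.eq_or_lt with rfl | hc'
  · rwa [sum_eq_single_of_mem 1 (mem_Icc.2 ⟨le_rfl, hcM⟩)] at h0
    intro a ha hne
    rw [mem_Icc] at ha
    exact hpos _ a rfl (by omega) ha.2
  · exact hpos _ c rfl hc' hcM

lemma drift_one {M : ℕ} {i b κ : ℕ → ℝ} (hκ : MartCoord M i b κ) {j : ℕ} (h2 : 2 ≤ j)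
    (hj : j ≤ M - 1) : qup i b j + qdn i b j = 1 := by
  obtain ⟨h1, h3⟩ := hκ.2 j h2 hj
  have := coord_lt hκ.1 (a := j - 1) (c := j + 1) (by omega) (by omega) (by omega)
  rw [h1, h3, ← add_div, div_eq_one_iff_eq (by linarith)]
  ring

lemma drift_coord {M : ℕ} {i b κ : ℕ → ℝ} (hκ : MartCoord M i b κ) {j : ℕ} (h2 : 2 ≤ j)
    (hj : j ≤ M - 1) : qup i b j * κ (j + 1) + qdn i b j * κ (j - 1) - κ j = 0 := by
  obtain ⟨h1, h3⟩ := hκ.2 j h2 hj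
  have := coord_lt hκ.1 (a := j - 1) (c := j + 1) (by omega) (by omega) (by omega)
  have hne : κ (j + 1) - κ (j - 1) ≠ 0 := by linarith
  rw [h1, h3]
  field_simp
  ring

lemma drift_hinge_self {M : ℕ} {i b κ : ℕ → ℝ} (hκ : MartCoord M i b κ) {x : ℕ} (h2 : 2 ≤ x)
    (hx : x ≤ M - 1) :
    qup i b x * max (κ (x + 1) - κ x) 0 + qdn i b x * max (κ (x - 1) - κ x) 0 -
      max (κ x - κ x) 0 = cellFactor κ x := by
  have h3 := coord_lt hκ.1 (a := x) (c := x + 1) (by omega) (by omega) (by omega)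
  have h4 := coord_lt hκ.1 (a := x - 1) (c := x) (by omega) (by omega) (by omega)
  rw [max_eq_left (by linarith), max_eq_right (by linarith), sub_self, max_self,
    (hκ.2 x h2 hx).1, cellFactor]
  ring

lemma drift_hinge_of_ne {M : ℕ} {i b κ : ℕ → ℝ} (hκ : MartCoord M i b κ) {x j : ℕ} (h2 : 2 ≤ x)
    (hx : x ≤ M - 1) (hj2 : 2 ≤ j) (hj : j ≤ M - 1) (hne : j ≠ x) :
    qup i b j * max (κ (j + 1) - κ x) 0 + qdn i b j * max (κ (j - 1) - κ x) 0 -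
      max (κ j - κ x) 0 = 0 := by
  rcases hne.lt_or_gt with h | h
  · have h3 := coord_le hκ.1 (a := j + 1) (c := x) (by omega) (by omega) (by omega)
    have h4 := coord_le hκ.1 (a := j) (c := x) (by omega) (by omega) (by omega)
    have h5 := coord_le hκ.1 (a := j - 1) (c := x) (by omega) (by omega) (by omega)
    rw [max_eq_right (by linarith), max_eq_right (by linarith), max_eq_right (by linarith)]
    ring
  · have h3 := coord_le hκ.1 (a := x) (c := j + 1) (by omega) (by omega) (by omega)
    have h4 := coord_le hκ.1 (a := x) (c := j) (by omega) (by omega) (by omega)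
    have h5 := coord_le hκ.1 (a := x) (c := j - 1) (by omega) (by omega) (by omega)
    rw [max_eq_left (by linarith), max_eq_left (by linarith), max_eq_left (by linarith)]
    linear_combination drift_coord hκ hj2 hj - κ x * drift_one hκ hj2 hj

section Moments

variable {M : ℕ} {t : ℝ} {i b k κ p lam : ℕ → ℝ} {α : ℝ}

lemma sum_rowEntry (hM : 3 ≤ M) (hκ : MartCoord M i b κ) (hlam : IntensityVec M lam) :
    ∑ c ∈ Icc 1 M, rowEntry M t i b k p α lam c =
      α * ∑ j ∈ Icc 1 M, killWeight t p lam (ktil M i k) j := by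
  have h := sum_rowEntry_mul hM t i b k p α hlam fun _ => 1
  simp only [mul_one] at h
  rw [h]
  congr 1
  refine sum_congr rfl fun j _ => ?_
  by_cases hj : 2 ≤ j ∧ j ≤ M - 1
  · rw [drift_one hκ hj.1 hj.2]
    ring
  · rw [hlam.2 j hj]
    ring

lemma sum_rowEntry_mul_coord (hM : 3 ≤ M) (hκ : MartCoord M i b κ) (hlam : IntensityVec M lam) :
    ∑ c ∈ Icc 1 M, rowEntry M t i b k p α lam c * κ c =
      α * ∑ j ∈ Icc 1 M, κ j * killWeight t p lam (ktil M i k) j := by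
  rw [sum_rowEntry_mul hM t i b k p α hlam κ]
  congr 1
  refine sum_congr rfl fun j _ => ?_
  by_cases hj : 2 ≤ j ∧ j ≤ M - 1
  · rw [drift_coord hκ hj.1 hj.2]
    ring
  · rw [hlam.2 j hj]
    ring

lemma sum_rowEntry_mul_hinge (hM : 3 ≤ M) (hκ : MartCoord M i b κ) (hlam : IntensityVec M lam)
    {x : ℕ} (h2 : 2 ≤ x) (hx : x ≤ M - 1) :
    ∑ c ∈ Icc 1 M, rowEntry M t i b k p α lam c * max (κ c - κ x) 0 =
      α * (∑ a ∈ Icc (x + 1) M, (κ a - κ x) * killWeight t p lam (ktil M i k) a -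
        t * lam x * p x * cellFactor κ x) := by
  rw [sum_rowEntry_mul hM t i b k p α hlam fun c => max (κ c - κ x) 0, sum_sub_distrib,
    sum_mul_hinge hκ.1 (by omega) (by omega)]
  congr 2
  rw [sum_eq_single_of_mem x (mem_Icc.2 ⟨by omega, by omega⟩), drift_hinge_self hκ h2 hx]
  · ring
  · intro j _ hne
    by_cases hj : 2 ≤ j ∧ j ≤ M - 1
    · rw [drift_hinge_of_ne hκ h2 hx hj.1 hj.2 hne]
      ring
    · rw [hlam.2 j hj]
      ring

/-- The column equations are equivalent to the matching of masses, means and call prices. -/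
lemma rowEntry_eq_iff (hM : 3 ≤ M) (hκ : MartCoord M i b κ) (hp : ProbVec M p)
    (hlam : IntensityVec M lam) {l : ℕ} (hl : 2 ≤ l) (hlM : l ≤ M) {x0 : ℝ} :
    (∀ c, 1 ≤ c → c ≤ M + 1 → rowEntry M t i b k p α lam c = twoPoint κ l x0 c) ↔
      α * ∑ j ∈ Icc 1 M, killWeight t p lam (ktil M i k) j = 1 ∧
      α * ∑ j ∈ Icc 1 M, κ j * killWeight t p lam (ktil M i k) j = x0 ∧
      ∀ x, 2 ≤ x → x ≤ M - 1 →
        α * (∑ a ∈ Icc (x + 1) M, (κ a - κ x) * killWeight t p lam (ktil M i k) a -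
          t * lam x * p x * cellFactor κ x) = if l ≤ x then 0 else x0 - κ x := by
  have hd := coord_lt hκ.1 (a := l - 1) (c := l) (by omega) (by omega) hlM
  have hne : κ l - κ (l - 1) ≠ 0 := by linarith
  have m0 : ∑ c ∈ Icc 1 M, twoPoint κ l x0 c = 1 := by
    have h := sum_twoPoint_mul hl hlM κ x0 fun _ => 1
    simp only [mul_one] at h
    rw [h]
    field_simp
    ring
  have m1 : ∑ c ∈ Icc 1 M, twoPoint κ l x0 c * κ c = x0 := by
    rw [sum_twoPoint_mul hl hlM]
    field_simp
    ring
  have m2 : ∀ x, 2 ≤ x → x ≤ M - 1 →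
      ∑ c ∈ Icc 1 M, twoPoint κ l x0 c * max (κ c - κ x) 0 =
        if l ≤ x then 0 else x0 - κ x := by
    intro x hx hxM
    rw [sum_twoPoint_mul hl hlM κ x0 fun c => max (κ c - κ x) 0]
    split_ifs with h
    · have h3 := coord_le hκ.1 (a := l) (c := x) (by omega) h (by omega)
      rw [max_eq_right (by linarith), max_eq_right (by linarith)]
      ring
    · have h3 := coord_le hκ.1 (a := x) (c := l - 1) (by omega) (by omega) (by omega)
      rw [max_eq_left (by linarith), max_eq_left (by linarith)]
      field_simp
      ring
  constructor
  · intro h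
    have h' : ∀ f : ℕ → ℝ, ∑ c ∈ Icc 1 M, rowEntry M t i b k p α lam c * f c =
        ∑ c ∈ Icc 1 M, twoPoint κ l x0 c * f c := fun f =>
      sum_congr rfl fun c hc => by
        rw [mem_Icc] at hc
        rw [h c hc.1 (by omega)]
    refine ⟨?_, ?_, fun x hx hxM => ?_⟩
    · have := h' fun _ => 1
      simp only [mul_one] at this
      rw [← sum_rowEntry hM hκ hlam, this, m0]
    · rw [← sum_rowEntry_mul_coord hM hκ hlam, h', m1]
    · rw [← sum_rowEntry_mul_hinge hM hκ hlam hx hxM, h' fun c => max (κ c - κ x) 0, m2 x hx hxM]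
  · rintro ⟨h0, h1, h2⟩ c hc hcM
    rcases hcM.eq_or_lt with rfl | hc'
    · rw [rowEntry_last hM, ← sum_killWeight hp, h0, twoPoint, if_neg (by omega),
        if_neg (by omega), sub_self]
    · have := eq_zero_of_moments hM hκ.1
        (e := fun c => rowEntry M t i b k p α lam c - twoPoint κ l x0 c) ?_ ?_ ?_ c hc (by omega)
      · exact sub_eq_zero.1 this
      · rw [sum_sub_distrib, sum_rowEntry hM hκ hlam, h0, m0, sub_self]
      · simp only [sub_mul]
        rw [sum_sub_distrib, sum_rowEntry_mul_coord hM hκ hlam, h1, m1, sub_self]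
      · intro x hx hxM
        simp only [sub_mul]
        rw [sum_sub_distrib, sum_rowEntry_mul_hinge hM hκ hlam hx hxM, h2 x hx hxM,
          m2 x hx hxM, sub_self]

end Moments

lemma cellFactor_pos {M : ℕ} {κ : ℕ → ℝ} (hκ : ∀ j, 1 ≤ j → j ≤ M - 1 → κ j < κ (j + 1))
    {j : ℕ} (h2 : 2 ≤ j) (hj : j ≤ M - 1) : 0 < cellFactor κ j := by
  have h3 := coord_lt hκ (a := j) (c := j + 1) (by omega) (by omega) (by omega)
  have h4 := coord_lt hκ (a := j - 1) (c := j) (by omega) (by omega) (by omega)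
  exact div_pos (mul_pos (by linarith) (by linarith)) (by linarith)

/-- The equations of the G-system, written without division. -/
lemma gEquation_iff {M : ℕ} {t : ℝ} (ht : 0 < t) {κ p : ℕ → ℝ}
    (hκ : ∀ j, 1 ≤ j → j ≤ M - 1 → κ j < κ (j + 1)) (hp : ProbVec M p)
    {j : ℕ} (h2 : 2 ≤ j) (hj : j ≤ M - 1) (g S : ℝ) :
    g = (1 / (t * p j)) *
      ((κ (j + 1) - κ (j - 1)) / ((κ (j + 1) - κ j) * (κ j - κ (j - 1)))) * S ↔
    t * g * p j * cellFactor κ j = S := by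
  have hpj := hp.1 j (by omega) (by omega)
  have h3 := coord_lt hκ (a := j) (c := j + 1) (by omega) (by omega) (by omega)
  have h4 := coord_lt hκ (a := j - 1) (c := j) (by omega) (by omega) (by omega)
  have n3 : κ (j + 1) - κ j ≠ 0 := by linarith
  have n4 : κ j - κ (j - 1) ≠ 0 := by linarith
  have n5 : κ (j + 1) - κ (j - 1) ≠ 0 := by linarith
  have n6 := hpj.ne'
  have n7 := ht.ne'
  unfold cellFactor
  constructor
  · rintro rfl
    field_simp
  · rintro rfl
    field_simp

/-- The left potential `L_j = ∑_{a<j} (κ_j-κ_a)(p_a + m_a L_a)`. -/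
def leftPot (κ p m : ℕ → ℝ) (j : ℕ) : ℝ :=
  ∑ a ∈ (Icc 1 (j - 1)).attach, (κ j - κ a.1) * (p a.1 + m a.1 * leftPot κ p m a.1)
termination_by j
decreasing_by
  have := mem_Icc.1 a.2
  omega

/-- The right potential `R_j = ∑_{j<a≤M} (κ_a-κ_j)(p_a + m_a R_a)`. -/
def rightPot (M : ℕ) (κ p m : ℕ → ℝ) (j : ℕ) : ℝ :=
  ∑ a ∈ (Icc (j + 1) M).attach, (κ a.1 - κ j) * (p a.1 + m a.1 * rightPot M κ p m a.1)
termination_by M - j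
decreasing_by
  have := mem_Icc.1 a.2
  omega

lemma leftPot_eq (κ p m : ℕ → ℝ) (j : ℕ) :
    leftPot κ p m j = ∑ a ∈ Icc 1 (j - 1), (κ j - κ a) * (p a + m a * leftPot κ p m a) := by
  rw [leftPot]
  exact sum_attach (Icc 1 (j - 1)) fun a => (κ j - κ a) * (p a + m a * leftPot κ p m a)

lemma rightPot_eq (M : ℕ) (κ p m : ℕ → ℝ) (j : ℕ) :
    rightPot M κ p m j =
      ∑ a ∈ Icc (j + 1) M, (κ a - κ j) * (p a + m a * rightPot M κ p m a) := by
  rw [rightPot]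
  exact sum_attach (Icc (j + 1) M) fun a => (κ a - κ j) * (p a + m a * rightPot M κ p m a)

section Potentials

variable {M : ℕ} {κ p m : ℕ → ℝ}

lemma leftPot_nonneg (hκ : ∀ j, 1 ≤ j → j ≤ M - 1 → κ j < κ (j + 1))
    (hp : ∀ j, 1 ≤ j → j ≤ M → 0 < p j) (hm : ∀ j, 1 ≤ j → j ≤ M → 0 ≤ m j)
    (j : ℕ) (hj : j ≤ M) : 0 ≤ leftPot κ p m j := by
  induction j using Nat.strong_induction_on with
  | _ j ih =>
    rw [leftPot_eq]
    refine sum_nonneg fun a ha => ?_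
    rw [mem_Icc] at ha
    exact mul_nonneg (sub_nonneg.2 (coord_le hκ ha.1 (by omega) hj))
      (add_nonneg (hp a ha.1 (by omega)).le
        (mul_nonneg (hm a ha.1 (by omega)) (ih a (by omega) (by omega))))

lemma rightPot_nonneg (hκ : ∀ j, 1 ≤ j → j ≤ M - 1 → κ j < κ (j + 1))
    (hp : ∀ j, 1 ≤ j → j ≤ M → 0 < p j) (hm : ∀ j, 1 ≤ j → j ≤ M → 0 ≤ m j)
    (j : ℕ) (hj : 1 ≤ j) : 0 ≤ rightPot M κ p m j := by
  induction hn : M - j using Nat.strong_induction_on generalizing j with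
  | _ n ih =>
    rw [rightPot_eq]
    refine sum_nonneg fun a ha => ?_
    rw [mem_Icc] at ha
    exact mul_nonneg (sub_nonneg.2 (coord_le hκ hj (by omega) ha.2))
      (add_nonneg (hp a (by omega) ha.2).le
        (mul_nonneg (hm a (by omega) ha.2) (ih (M - a) (by omega) a (by omega) rfl)))

lemma leftPot_mono (hκ : ∀ j, 1 ≤ j → j ≤ M - 1 → κ j < κ (j + 1))
    (hp : ∀ j, 1 ≤ j → j ≤ M → 0 < p j) (hm : ∀ j, 1 ≤ j → j ≤ M → 0 ≤ m j)
    {x y : ℕ} (hx : 1 ≤ x) (hxy : x ≤ y) (hy : y ≤ M) :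
    leftPot κ p m x ≤ leftPot κ p m y := by
  have hw : ∀ a, 1 ≤ a → a ≤ M → 0 ≤ p a + m a * leftPot κ p m a := fun a h1 h2 =>
    add_nonneg (hp a h1 h2).le (mul_nonneg (hm a h1 h2) (leftPot_nonneg hκ hp hm a h2))
  have hκxy := coord_le hκ hx hxy hy
  rw [leftPot_eq, leftPot_eq κ p m y]
  refine (sum_le_sum fun a ha => ?_).trans
    (sum_le_sum_of_subset_of_nonneg (Icc_subset_Icc le_rfl (by omega)) fun a ha _ => ?_)
  · rw [mem_Icc] at ha
    exact mul_le_mul_of_nonneg_right (by linarith) (hw a ha.1 (by omega))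
  · rw [mem_Icc] at ha
    exact mul_nonneg (sub_nonneg.2 (coord_le hκ ha.1 (by omega) hy)) (hw a ha.1 (by omega))

lemma rightPot_anti (hκ : ∀ j, 1 ≤ j → j ≤ M - 1 → κ j < κ (j + 1))
    (hp : ∀ j, 1 ≤ j → j ≤ M → 0 < p j) (hm : ∀ j, 1 ≤ j → j ≤ M → 0 ≤ m j)
    {x y : ℕ} (hx : 1 ≤ x) (hxy : x ≤ y) (hy : y ≤ M) :
    rightPot M κ p m y ≤ rightPot M κ p m x := by
  have hw : ∀ a, 1 ≤ a → a ≤ M → 0 ≤ p a + m a * rightPot M κ p m a := fun a h1 h2 =>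
    add_nonneg (hp a h1 h2).le (mul_nonneg (hm a h1 h2) (rightPot_nonneg hκ hp hm a h1))
  have hκxy := coord_le hκ hx hxy hy
  rw [rightPot_eq, rightPot_eq M κ p m x]
  refine (sum_le_sum fun a ha => ?_).trans
    (sum_le_sum_of_subset_of_nonneg (Icc_subset_Icc (by omega) le_rfl) fun a ha _ => ?_)
  · rw [mem_Icc] at ha
    exact mul_le_mul_of_nonneg_right (by linarith) (hw a (by omega) ha.2)
  · rw [mem_Icc] at ha
    exact mul_nonneg (sub_nonneg.2 (coord_le hκ hx (by omega) ha.2)) (hw a (by omega) ha.2)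

lemma rightPot_one_pos (hM : 3 ≤ M) (hκ : ∀ j, 1 ≤ j → j ≤ M - 1 → κ j < κ (j + 1))
    (hp : ∀ j, 1 ≤ j → j ≤ M → 0 < p j) (hm : ∀ j, 1 ≤ j → j ≤ M → 0 ≤ m j) :
    0 < rightPot M κ p m 1 := by
  rw [rightPot_eq]
  refine sum_pos (fun a ha => ?_) ⟨M, mem_Icc.2 ⟨by omega, le_rfl⟩⟩
  rw [mem_Icc] at ha
  exact mul_pos (sub_pos.2 (coord_lt hκ le_rfl (by omega) ha.2))
    (add_pos_of_pos_of_nonneg (hp a (by omega) ha.2)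
      (mul_nonneg (hm a (by omega) ha.2) (rightPot_nonneg hκ hp hm a (by omega))))

/-- The two potentials cross at exactly one index. -/
lemma existsUnique_crossing (hM : 3 ≤ M) (hκ : ∀ j, 1 ≤ j → j ≤ M - 1 → κ j < κ (j + 1))
    (hp : ∀ j, 1 ≤ j → j ≤ M → 0 < p j) (hm : ∀ j, 1 ≤ j → j ≤ M → 0 ≤ m j) :
    ∃! l, 2 ≤ l ∧ l ≤ M ∧ leftPot κ p m (l - 1) < rightPot M κ p m (l - 1) ∧
      rightPot M κ p m l ≤ leftPot κ p m l := by
  classical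
  have hex : ∃ l, 1 ≤ l ∧ rightPot M κ p m l ≤ leftPot κ p m l := by
    refine ⟨M, by omega, ?_⟩
    rw [rightPot_eq, Icc_eq_empty (by omega), sum_empty]
    exact leftPot_nonneg hκ hp hm M le_rfl
  have hspec := Nat.find_spec hex
  have hmin : ∀ j, 1 ≤ j → j < Nat.find hex → leftPot κ p m j < rightPot M κ p m j :=
    fun j h1 hj => not_le.1 fun h => Nat.find_min hex hj ⟨h1, h⟩
  have hle : Nat.find hex ≤ M := by
    refine Nat.find_min' hex ⟨by omega, ?_⟩
    rw [rightPot_eq, Icc_eq_empty (by omega), sum_empty]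
    exact leftPot_nonneg hκ hp hm M le_rfl
  have hne : Nat.find hex ≠ 1 := by
    intro h
    have h' := hspec.2
    rw [h, leftPot_eq] at h'
    have := rightPot_one_pos hM hκ hp hm
    simp at h'
    linarith
  refine ⟨Nat.find hex, ⟨by omega, hle, hmin _ (by omega) (by omega), hspec.2⟩, ?_⟩
  rintro y ⟨hy2, hyM, hylt, hyle⟩
  have h1 : Nat.find hex ≤ y := Nat.find_min' hex ⟨by omega, hyle⟩
  by_contra hny
  have h3 := leftPot_mono hκ hp hm (x := Nat.find hex) (y := y - 1) (by omega) (by omega) (by omega)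
  have h4 := rightPot_anti hκ hp hm (x := Nat.find hex) (y := y - 1) (by omega) (by omega)
    (by omega)
  linarith [hspec.2]

end Potentials

section GSystem

variable {M : ℕ} {t : ℝ} {κ p kt lam : ℕ → ℝ}

lemma killWeight_eq (hκ : ∀ j, 1 ≤ j → j ≤ M - 1 → κ j < κ (j + 1))
    (hkt : ∀ j, ¬(2 ≤ j ∧ j ≤ M - 1) → kt j = 0) {a : ℕ} {V : ℝ}
    (h : 2 ≤ a → a ≤ M - 1 → t * lam a * p a * cellFactor κ a = V) :
    killWeight t p lam kt a = p a + kt a / cellFactor κ a * V := by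
  by_cases ha : 2 ≤ a ∧ a ≤ M - 1
  · have := (cellFactor_pos hκ ha.1 ha.2).ne'
    rw [← h ha.1 ha.2, killWeight]
    field_simp
  · rw [killWeight, hkt a ha]
    ring

lemma sum_left_eq_leftPot (hκ : ∀ j, 1 ≤ j → j ≤ M - 1 → κ j < κ (j + 1))
    (hkt : ∀ j, ¬(2 ≤ j ∧ j ≤ M - 1) → kt j = 0) {n : ℕ}
    (h : ∀ j, 2 ≤ j → j ≤ n → j ≤ M - 1 → t * lam j * p j * cellFactor κ j =
      leftPot κ p (fun a => kt a / cellFactor κ a) j) {j : ℕ} (hj : j ≤ n + 1) :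
    ∑ a ∈ Icc 1 (j - 1), (κ j - κ a) * killWeight t p lam kt a =
      leftPot κ p (fun a => kt a / cellFactor κ a) j := by
  rw [leftPot_eq]
  refine sum_congr rfl fun a ha => ?_
  rw [mem_Icc] at ha
  rw [killWeight_eq hκ hkt fun h2 hM => h a h2 (by omega) hM]

lemma sum_right_eq_rightPot (hκ : ∀ j, 1 ≤ j → j ≤ M - 1 → κ j < κ (j + 1))
    (hkt : ∀ j, ¬(2 ≤ j ∧ j ≤ M - 1) → kt j = 0) {n : ℕ}
    (h : ∀ j, 2 ≤ j → n ≤ j → j ≤ M - 1 → t * lam j * p j * cellFactor κ j =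
      rightPot M κ p (fun a => kt a / cellFactor κ a) j) {j : ℕ} (hj : n ≤ j + 1) :
    ∑ a ∈ Icc (j + 1) M, (κ a - κ j) * killWeight t p lam kt a =
      rightPot M κ p (fun a => kt a / cellFactor κ a) j := by
  rw [rightPot_eq]
  refine sum_congr rfl fun a ha => ?_
  rw [mem_Icc] at ha
  rw [killWeight_eq hκ hkt fun h2 hM => h a h2 (by omega) hM]

lemma left_equations_iff (hκ : ∀ j, 1 ≤ j → j ≤ M - 1 → κ j < κ (j + 1))
    (hkt : ∀ j, ¬(2 ≤ j ∧ j ≤ M - 1) → kt j = 0) {n : ℕ} :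
    (∀ j, 2 ≤ j → j ≤ n → j ≤ M - 1 → t * lam j * p j * cellFactor κ j =
      ∑ a ∈ Icc 1 (j - 1), (κ j - κ a) * killWeight t p lam kt a) ↔
    ∀ j, 2 ≤ j → j ≤ n → j ≤ M - 1 → t * lam j * p j * cellFactor κ j =
      leftPot κ p (fun a => kt a / cellFactor κ a) j := by
  refine ⟨fun h j => ?_, fun h j h2 hn hM => ?_⟩
  · induction j using Nat.strong_induction_on with
    | _ j ih =>
      intro h2 hn hM
      rw [h j h2 hn hM]
      exact sum_left_eq_leftPot hκ hkt (n := j - 1)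
        (fun a ha ha' => ih a (by omega) ha (by omega)) (by omega)
  · rw [h j h2 hn hM, sum_left_eq_leftPot hκ hkt h (by omega)]

lemma right_equations_iff (hκ : ∀ j, 1 ≤ j → j ≤ M - 1 → κ j < κ (j + 1))
    (hkt : ∀ j, ¬(2 ≤ j ∧ j ≤ M - 1) → kt j = 0) {n : ℕ} :
    (∀ j, 2 ≤ j → n ≤ j → j ≤ M - 1 → t * lam j * p j * cellFactor κ j =
      ∑ a ∈ Icc (j + 1) M, (κ a - κ j) * killWeight t p lam kt a) ↔
    ∀ j, 2 ≤ j → n ≤ j → j ≤ M - 1 → t * lam j * p j * cellFactor κ j =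
      rightPot M κ p (fun a => kt a / cellFactor κ a) j := by
  refine ⟨fun h j => ?_, fun h j h2 hn hM => ?_⟩
  · induction hd : M - j using Nat.strong_induction_on generalizing j with
    | _ d ih =>
      intro h2 hn hM
      rw [h j h2 hn hM]
      exact sum_right_eq_rightPot hκ hkt (n := j + 1)
        (fun a ha ha' hM' => ih (M - a) (by omega) a rfl ha (by omega) hM') (by omega)
  · rw [h j h2 hn hM, sum_right_eq_rightPot hκ hkt h (by omega)]

lemma Gx0_eq : Gx0 M t κ kt p lam =
    (∑ j ∈ Icc 1 M, κ j * killWeight t p lam kt j) / ∑ j ∈ Icc 1 M, killWeight t p lam kt j := by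
  simp only [Gx0, killWeight, mul_assoc]

lemma sum_killWeight_pos (hM : 3 ≤ M) (ht : 0 < t) (hp : ProbVec M p) (hkt : ∀ j, 0 ≤ kt j)
    (hlam : ∀ j, 1 ≤ j → j ≤ M → 0 ≤ lam j) : 0 < ∑ j ∈ Icc 1 M, killWeight t p lam kt j := by
  refine sum_pos (fun a ha => ?_) ⟨M, mem_Icc.2 ⟨by omega, le_rfl⟩⟩
  rw [mem_Icc] at ha
  have := mul_nonneg (mul_nonneg ht.le (hlam a ha.1 ha.2)) (hkt a)
  exact mul_pos (hp.1 a ha.1 ha.2) (by linarith)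

lemma IntensityVec.nonneg (hlam : IntensityVec M lam) (j : ℕ) : 0 ≤ lam j := by
  by_cases h : 2 ≤ j ∧ j ≤ M - 1
  · exact hlam.1 j h.1 h.2
  · exact (hlam.2 j h).ge

/-- The G-system with the quotients cleared. -/
lemma gSystem_iff (hM : 3 ≤ M) (ht : 0 < t)
    (hκ : ∀ j, 1 ≤ j → j ≤ M - 1 → κ j < κ (j + 1)) (hp : ProbVec M p)
    (hlam : IntensityVec M lam) {l : ℕ} :
    GSystem M t κ kt p lam l ↔ 2 ≤ l ∧ l ≤ M ∧
      κ (l - 1) < Gx0 M t κ kt p lam ∧ Gx0 M t κ kt p lam ≤ κ l ∧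
      (∀ j, 2 ≤ j → j ≤ l - 1 → j ≤ M - 1 → t * lam j * p j * cellFactor κ j =
        ∑ a ∈ Icc 1 (j - 1), (κ j - κ a) * killWeight t p lam kt a) ∧
      ∀ j, 2 ≤ j → l ≤ j → j ≤ M - 1 → t * lam j * p j * cellFactor κ j =
        ∑ a ∈ Icc (j + 1) M, (κ a - κ j) * killWeight t p lam kt a := by
  simp only [GSystem, killWeight, mul_assoc (κ _ - κ _)]
  constructor
  · rintro ⟨h1, h2, -, -, -, h3, h4, h5, h6⟩
    exact ⟨h1, h2, h3, h4, fun j hj hjl hjM => (gEquation_iff ht hκ hp hj hjM _ _).1 (h5 j hj hjl),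
      fun j hj hjl hjM => (gEquation_iff ht hκ hp hj hjM _ _).1 (h6 j hjl hjM)⟩
  · rintro ⟨h1, h2, h3, h4, h5, h6⟩
    exact ⟨h1, h2, fun j _ _ => hlam.nonneg j, hlam.2 1 (by omega), hlam.2 M (by omega), h3, h4,
      fun j hj hjl => (gEquation_iff ht hκ hp hj (by omega) _ _).2 (h5 j hj hjl (by omega)),
      fun j hjl hjM => (gEquation_iff ht hκ hp (by omega) hjM _ _).2 (h6 j (by omega) hjl hjM)⟩

/-- The G-system in terms of the potentials. -/
lemma gSystem_iff_pot (hM : 3 ≤ M) (ht : 0 < t)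
    (hκ : ∀ j, 1 ≤ j → j ≤ M - 1 → κ j < κ (j + 1)) (hp : ProbVec M p)
    (hkt : ∀ j, ¬(2 ≤ j ∧ j ≤ M - 1) → kt j = 0) (hkt0 : ∀ j, 0 ≤ kt j)
    (hlam : IntensityVec M lam) {l : ℕ} :
    GSystem M t κ kt p lam l ↔
      (2 ≤ l ∧ l ≤ M ∧
        leftPot κ p (fun a => kt a / cellFactor κ a) (l - 1) <
          rightPot M κ p (fun a => kt a / cellFactor κ a) (l - 1) ∧
        rightPot M κ p (fun a => kt a / cellFactor κ a) l ≤
          leftPot κ p (fun a => kt a / cellFactor κ a) l) ∧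
      (∀ j, 2 ≤ j → j ≤ l - 1 → j ≤ M - 1 → t * lam j * p j * cellFactor κ j =
        leftPot κ p (fun a => kt a / cellFactor κ a) j) ∧
      ∀ j, 2 ≤ j → l ≤ j → j ≤ M - 1 → t * lam j * p j * cellFactor κ j =
        rightPot M κ p (fun a => kt a / cellFactor κ a) j := by
  have hS := sum_killWeight_pos hM ht hp hkt0 fun j _ _ => hlam.nonneg j
  rw [gSystem_iff hM ht hκ hp hlam, left_equations_iff hκ hkt, right_equations_iff hκ hkt, Gx0_eq,
    lt_div_iff₀ hS, div_le_iff₀ hS]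
  constructor
  · rintro ⟨h1, h2, h3, h4, h5, h6⟩
    refine ⟨⟨h1, h2, ?_, ?_⟩, h5, h6⟩
    · have h := sum_left_eq (x := l - 1) (M := M) (by omega) (by omega) κ (killWeight t p lam kt)
      rw [sum_left_eq_leftPot hκ hkt h5 (by omega),
        sum_right_eq_rightPot hκ hkt h6 (by omega)] at h
      linarith
    · have h := sum_left_eq (x := l) (M := M) (by omega) (by omega) κ (killWeight t p lam kt)
      rw [sum_left_eq_leftPot hκ hkt h5 (by omega),
        sum_right_eq_rightPot hκ hkt h6 (by omega)] at h
      linarith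
  · rintro ⟨⟨h1, h2, h3, h4⟩, h5, h6⟩
    refine ⟨h1, h2, ?_, ?_, h5, h6⟩
    · have h := sum_left_eq (x := l - 1) (M := M) (by omega) (by omega) κ (killWeight t p lam kt)
      rw [sum_left_eq_leftPot hκ hkt h5 (by omega),
        sum_right_eq_rightPot hκ hkt h6 (by omega)] at h
      linarith
    · have h := sum_left_eq (x := l) (M := M) (by omega) (by omega) κ (killWeight t p lam kt)
      rw [sum_left_eq_leftPot hκ hkt h5 (by omega),
        sum_right_eq_rightPot hκ hkt h6 (by omega)] at h
      linarith

/-- The G-system has exactly one solution. -/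
lemma exists_gSystem (hM : 3 ≤ M) (ht : 0 < t)
    (hκ : ∀ j, 1 ≤ j → j ≤ M - 1 → κ j < κ (j + 1)) (hp : ProbVec M p)
    (hkt : ∀ j, ¬(2 ≤ j ∧ j ≤ M - 1) → kt j = 0) (hkt0 : ∀ j, 0 ≤ kt j) :
    ∃ lam l, IntensityVec M lam ∧ GSystem M t κ kt p lam l ∧
      ∀ lam' l', IntensityVec M lam' → GSystem M t κ kt p lam' l' → lam' = lam ∧ l' = l := by
  have hm : ∀ j, 1 ≤ j → j ≤ M → 0 ≤ kt j / cellFactor κ j := by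
    intro j _ _
    by_cases h : 2 ≤ j ∧ j ≤ M - 1
    · exact div_nonneg (hkt0 j) (cellFactor_pos hκ h.1 h.2).le
    · rw [hkt j h, zero_div]
  have hpos : ∀ j, 2 ≤ j → j ≤ M - 1 → 0 < t * p j * cellFactor κ j := fun j h2 hj =>
    mul_pos (mul_pos ht (hp.1 j (by omega) (by omega))) (cellFactor_pos hκ h2 hj)
  obtain ⟨l, hl, hlu⟩ := existsUnique_crossing hM hκ hp.1 hm
  have hlam : IntensityVec M fun j => if 2 ≤ j ∧ j ≤ M - 1 then
      (if j < l then leftPot κ p (fun a => kt a / cellFactor κ a) j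
        else rightPot M κ p (fun a => kt a / cellFactor κ a) j) / (t * p j * cellFactor κ j)
      else 0 := by
    refine ⟨fun j h2 hj => ?_, fun j hj => if_neg hj⟩
    dsimp only
    rw [if_pos ⟨h2, hj⟩]
    refine div_nonneg ?_ (hpos j h2 hj).le
    split_ifs
    · exact leftPot_nonneg hκ hp.1 hm j (by omega)
    · exact rightPot_nonneg hκ hp.1 hm j (by omega)
  have hsys := (gSystem_iff_pot hM ht hκ hp hkt hkt0 hlam (l := l)).2 ⟨hl, ?_, ?_⟩
  · refine ⟨_, l, hlam, hsys, fun lam' l' hlam' hsys' => ?_⟩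
    obtain ⟨-, hL, hR⟩ := (gSystem_iff_pot hM ht hκ hp hkt hkt0 hlam).1 hsys
    obtain ⟨hl', hL', hR'⟩ := (gSystem_iff_pot hM ht hκ hp hkt hkt0 hlam').1 hsys'
    obtain rfl := hlu l' hl'
    refine ⟨funext fun j => ?_, rfl⟩
    by_cases h : 2 ≤ j ∧ j ≤ M - 1
    · have hc := hpos j h.1 h.2
      refine mul_left_cancel₀ hc.ne' ?_
      rcases lt_or_ge j l' with hjl | hjl
      · linear_combination hL' j h.1 (by omega) h.2 - hL j h.1 (by omega) h.2
      · linear_combination hR' j h.1 hjl h.2 - hR j h.1 hjl h.2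
    · rw [hlam'.2 j h, if_neg h]
  · intro j h2 hjl hj
    have := (hpos j h2 hj).ne'
    rw [if_pos ⟨h2, hj⟩, if_pos (by omega), mul_right_comm t, mul_right_comm (t * p j),
      mul_div_cancel₀ _ this]
  · intro j h2 hjl hj
    have := (hpos j h2 hj).ne'
    rw [if_pos ⟨h2, hj⟩, if_neg (by omega), mul_right_comm t, mul_right_comm (t * p j),
      mul_div_cancel₀ _ this]

end GSystem

/-- Solving the row equations amounts to solving the G-system. -/
lemma sol1_iff {M : ℕ} (hM : 3 ≤ M) {i b k κ p : ℕ → ℝ} {t : ℝ} (ht : 0 < t)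
    (hκ : MartCoord M i b κ) (hp : ProbVec M p) (hkt0 : ∀ j, 0 ≤ ktil M i k j)
    {α : ℝ} {l : ℕ} {x0 : ℝ} {lam : ℕ → ℝ} :
    Sol1 M t i b k κ p α l x0 lam ↔ IntensityVec M lam ∧
      α = 1 / (1 + t * ∑ j ∈ Icc 1 M, p j * lam j * ktil M i k j) ∧
      x0 = Gx0 M t κ (ktil M i k) p lam ∧ GSystem M t κ (ktil M i k) p lam l := by
  unfold Sol1
  refine and_congr_right fun hlam => ?_
  have hS := sum_killWeight_pos hM ht hp hkt0 fun j _ _ => hlam.nonneg j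
  rw [gSystem_iff hM ht hκ.1 hp hlam, ← sum_killWeight hp, Gx0_eq]
  constructor
  · rintro ⟨hα, -, h1, h2, h3, h4, h5⟩
    obtain ⟨e0, e1, e2⟩ := (rowEntry_eq_iff hM hκ hp hlam h1 h2).1 h5
    have hαS := eq_one_div_of_mul_eq_one_left e0
    have hx : x0 = (∑ j ∈ Icc 1 M, κ j * killWeight t p lam (ktil M i k) j) /
        ∑ j ∈ Icc 1 M, killWeight t p lam (ktil M i k) j := by
      rw [← e1, hαS]
      ring
    rw [← hx]
    refine ⟨hαS, rfl, h1, h2, h3, h4, fun j hj hjl hjM => ?_, fun j hj hjl hjM => ?_⟩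
    · have h := e2 j hj hjM
      rw [if_neg (by omega)] at h
      rw [sum_left_eq (M := M) (by omega) (by omega)]
      refine mul_left_cancel₀ hα.ne' ?_
      linear_combination e1 - κ j * e0 - h
    · have h := e2 j hj hjM
      rw [if_pos hjl] at h
      rcases mul_eq_zero.1 h with h | h
      · exact absurd h hα.ne'
      · linarith
  · rintro ⟨hα, hx, h1, h2, h3, h4, h5, h6⟩
    have e0 : α * ∑ j ∈ Icc 1 M, killWeight t p lam (ktil M i k) j = 1 := by
      rw [hα, one_div_mul_cancel hS.ne']
    have e1 : α * ∑ j ∈ Icc 1 M, κ j * killWeight t p lam (ktil M i k) j = x0 := by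
      rw [hα, hx]
      ring
    have hS1 : 1 ≤ ∑ j ∈ Icc 1 M, killWeight t p lam (ktil M i k) j := by
      rw [sum_killWeight hp]
      have : 0 ≤ ∑ j ∈ Icc 1 M, p j * lam j * ktil M i k j := sum_nonneg fun j hj => by
        rw [mem_Icc] at hj
        exact mul_nonneg (mul_nonneg (hp.1 j hj.1 hj.2).le (hlam.nonneg j)) (hkt0 j)
      have := mul_nonneg ht.le this
      linarith
    rw [← hx] at h3 h4
    refine ⟨hα ▸ one_div_pos.2 hS, ?_, h1, h2, h3, h4,
      (rowEntry_eq_iff hM hκ hp hlam h1 h2).2 ⟨e0, e1, fun x hx2 hxM => ?_⟩⟩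
    · rw [hα]
      exact (div_le_one hS).2 hS1
    · split_ifs with hlx
      · rw [h6 x hx2 hlx hxM, sub_self, mul_zero]
      · rw [h5 x hx2 (by omega) hxM, sum_left_eq (M := M) (by omega) (by omega)]
        linear_combination e1 - κ x * e0

/-- There is a unique `(α, l, x₀, λ)` solving the system of Lemma 5
(`p̂ · Ñ_t(λ)` concentrated on `{l-1, l}` as above); moreover any solution satisfies the
explicit formulas for `α` and `x₀`, and `(λ, l)` solves the G-system with time parameter
`t` and probability vector `p`. -/
theorem stmt_1 (M : ℕ) (hM : 3 ≤ M) (i b k κ p : ℕ → ℝ) (t : ℝ) (ht : 0 < t)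
    (hi : ∀ j, 1 ≤ j → j ≤ M - 1 → i j < i (j + 1))
    (hb : DriftHyp M i b)
    (hk : ∀ j, 2 ≤ j → j ≤ M - 1 → 0 ≤ k j)
    (hκ : MartCoord M i b κ)
    (hp : ProbVec M p) :
    (∃! q : ℝ × ℕ × ℝ × (ℕ → ℝ), Sol1 M t i b k κ p q.1 q.2.1 q.2.2.1 q.2.2.2) ∧
    (∀ α l x0 lam, Sol1 M t i b k κ p α l x0 lam →
      α = 1 / (1 + t * ∑ j ∈ Finset.Icc 1 M, p j * lam j * ktil M i k j) ∧
      x0 = (∑ j ∈ Finset.Icc 1 M, κ j * p j * (1 + t * lam j * ktil M i k j)) /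
            (∑ j ∈ Finset.Icc 1 M, p j * (1 + t * lam j * ktil M i k j)) ∧
      GSystem M t κ (ktil M i k) p lam l) := by
  have hkt0 := ktil_nonneg hi hk
  have hiff : ∀ α l x0 lam, Sol1 M t i b k κ p α l x0 lam ↔ IntensityVec M lam ∧
      α = 1 / (1 + t * ∑ j ∈ Icc 1 M, p j * lam j * ktil M i k j) ∧
      x0 = Gx0 M t κ (ktil M i k) p lam ∧ GSystem M t κ (ktil M i k) p lam l :=
    fun _ _ _ _ => sol1_iff hM ht hκ hp hkt0
  refine ⟨?_, fun α l x0 lam h => ((hiff α l x0 lam).1 h).2⟩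
  obtain ⟨lam, l, hlam, hsys, huniq⟩ := exists_gSystem hM ht hκ.1 hp
    (fun j hj => ktil_eq_zero i k hj) hkt0
  refine ⟨(1 / (1 + t * ∑ j ∈ Icc 1 M, p j * lam j * ktil M i k j), l,
    Gx0 M t κ (ktil M i k) p lam, lam), (hiff _ _ _ _).2 ⟨hlam, rfl, rfl, hsys⟩, ?_⟩
  rintro ⟨α', l', x0', lam'⟩ h
  obtain ⟨hlam', hα', hx', hsys'⟩ := (hiff _ _ _ _).1 h
  obtain ⟨hl1, hl2⟩ := huniq lam' l' hlam' hsys'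
  dsimp only at hl1 hl2 hα' hx'
  subst hl1 hl2 hα' hx'
  rfl
end
end
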